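/- arXiv:math/0405196 — 2 statements merged into one kernel-verified Lean document; each statement's English description precedes it below -/
import Mathlib

section
/- Let d ≥ 1, let 0 ≤ n ≤ 2d−2, and let V be a two-dimensional complex subspace of the space of complex polynomials of degree at most d such that the Wronskian of some basis of V equals c·zⁿ for some c ∈ ℂ, c ≠ 0. Then V = span_ℂ{z^k, z^m} for some integers 0 ≤ k < m ≤ d with k + m = n + 1. -/
open Polynomial

namespace Polynomial

section CommRing

variable {R : Type*} [CommRing R]

theorem coeff_mul_add_of_lt_coeff_eq_zero {p q : R[X]} {a b : ℕ}
    (hp : ∀ i < a, p.coeff i = 0) (hq : ∀ i < b, q.coeff i = 0) :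
    (p * q).coeff (a + b) = p.coeff a * q.coeff b := by
  obtain ⟨p, rfl⟩ := X_pow_dvd_iff.2 hp
  obtain ⟨q, rfl⟩ := X_pow_dvd_iff.2 hq
  have h : X ^ a * p * (X ^ b * q) = X ^ (a + b) * (p * q) := by ring
  have key (k : ℕ) (s : R[X]) : (X ^ k * s).coeff k = s.coeff 0 := by
    simpa using coeff_X_pow_mul s k 0
  rw [h, key, key, key, mul_coeff_zero]

theorem coeff_X_mul_derivative (p : R[X]) (k : ℕ) :
    (X * derivative p).coeff k = k * p.coeff k := by
  cases k with
  | zero => simp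
  | succ k => rw [coeff_X_mul, coeff_derivative]; push_cast; ring

theorem X_mul_wronskian (p q : R[X]) :
    X * wronskian p q = p * (X * derivative q) - (X * derivative p) * q := by
  rw [wronskian]; ring

theorem coeff_X_mul_wronskian_of_natDegree_le {p q : R[X]} {e f : ℕ}
    (hp : p.natDegree ≤ e) (hq : q.natDegree ≤ f) :
    (X * wronskian p q).coeff (e + f) = (f - e) * (p.coeff e * q.coeff f) := by
  have key {s : R[X]} {k : ℕ} (hs : s.natDegree ≤ k) : (X * derivative s).natDegree ≤ k :=
    natDegree_le_iff_coeff_eq_zero.2 fun i hi => by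
      rw [coeff_X_mul_derivative, natDegree_le_iff_coeff_eq_zero.1 hs i hi, mul_zero]
  rw [X_mul_wronskian, coeff_sub, coeff_mul_add_eq_of_natDegree_le hp (key hq),
    coeff_mul_add_eq_of_natDegree_le (key hp) hq, coeff_X_mul_derivative, coeff_X_mul_derivative]
  ring

theorem coeff_X_mul_wronskian_of_lt_coeff_eq_zero {p q : R[X]} {a b : ℕ}
    (hp : ∀ i < a, p.coeff i = 0) (hq : ∀ i < b, q.coeff i = 0) :
    (X * wronskian p q).coeff (a + b) = (b - a) * (p.coeff a * q.coeff b) := by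
  have key {s : R[X]} {k : ℕ} (hs : ∀ i < k, s.coeff i = 0) :
      ∀ i < k, (X * derivative s).coeff i = 0 := fun i hi => by
    rw [coeff_X_mul_derivative, hs i hi, mul_zero]
  rw [X_mul_wronskian, coeff_sub, coeff_mul_add_of_lt_coeff_eq_zero hp (key hq),
    coeff_mul_add_of_lt_coeff_eq_zero (key hp) hq, coeff_X_mul_derivative, coeff_X_mul_derivative]
  ring

theorem wronskian_add_smul_self (p q : R[X]) (t : R) :
    wronskian p (q + t • p) = wronskian p q := by
  rw [wronskian_add_right, ← wronskianBilin_apply p (t • p), map_smul, wronskianBilin_apply,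
    wronskian_self_eq_zero, smul_zero, add_zero]

theorem eq_C_mul_X_pow_of_natDegree_le_natTrailingDegree {p : R[X]}
    (h : p.natDegree ≤ p.natTrailingDegree) : p = C p.leadingCoeff * X ^ p.natDegree := by
  ext i
  rw [coeff_C_mul_X_pow]
  split_ifs with hi
  · rw [hi, leadingCoeff]
  · rcases lt_or_gt_of_ne hi with hi | hi
    · exact coeff_eq_zero_of_lt_natTrailingDegree (hi.trans_le h)
    · exact coeff_eq_zero_of_natDegree_lt hi

end CommRing

section Field

variable {K : Type*} [Field K]

theorem span_pair_add_smul_self (p q : K[X]) (t : K) :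
    Submodule.span K {p, q + t • p} = Submodule.span K {p, q} := by
  refine le_antisymm ?_ ?_ <;> rw [Submodule.span_le, Set.pair_subset_iff] <;>
    refine ⟨Submodule.subset_span (by simp), ?_⟩
  · exact Submodule.mem_span_pair.2 ⟨t, 1, by simp [add_comm]⟩
  · exact Submodule.mem_span_pair.2 ⟨-t, 1, by simp⟩

theorem span_pair_C_mul {a b : K} (ha : a ≠ 0) (hb : b ≠ 0) (p q : K[X]) :
    Submodule.span K {C a * p, C b * q} = Submodule.span K {p, q} := by
  rw [Submodule.span_insert, Submodule.span_insert, ← smul_eq_C_mul, ← smul_eq_C_mul,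
    Submodule.span_singleton_smul_eq ha.isUnit, Submodule.span_singleton_smul_eq hb.isUnit]

/-- A pair with nonzero Wronskian can be replaced by one with the same span, and the same
Wronskian up to sign, whose degrees are distinct. -/
theorem exists_natDegree_lt_of_wronskian_ne_zero {r q : K[X]} (h : wronskian r q ≠ 0) :
    ∃ p g : K[X], p.natDegree < g.natDegree ∧
      Submodule.span K {p, g} = Submodule.span K {r, q} ∧
      (wronskian p g = wronskian r q ∨ wronskian p g = -wronskian r q) := by
  rcases lt_trichotomy r.natDegree q.natDegree with hlt | heq | hgt
  · exact ⟨r, q, hlt, rfl, .inl rfl⟩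
  · have hr : r ≠ 0 := by rintro rfl; simp at h
    set t : K := -(q.leadingCoeff / r.leadingCoeff)
    have hW := wronskian_add_smul_self r q t
    have hle : (q + t • r).natDegree ≤ r.natDegree :=
      natDegree_add_le_of_degree_le heq.ge (natDegree_smul_le t r)
    have hcoeff : (q + t • r).coeff r.natDegree = 0 := by
      have : r.leadingCoeff ≠ 0 := leadingCoeff_ne_zero.2 hr
      rw [coeff_add, coeff_smul, coeff_natDegree, heq, coeff_natDegree, smul_eq_mul]
      simp only [t]
      field_simp
      ring
    refine ⟨q + t • r, r, lt_of_le_of_ne hle fun he => h ?_, ?_, .inr ?_⟩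
    · rw [← hW, leadingCoeff_eq_zero.1 (by rw [leadingCoeff, he, hcoeff] :
        (q + t • r).leadingCoeff = 0), wronskian_zero_right]
    · rw [Set.pair_comm, span_pair_add_smul_self]
    · rw [← wronskian_neg_eq, hW]
  · exact ⟨q, r, hgt, by rw [Set.pair_comm], .inr (wronskian_neg_eq r q).symm⟩

variable [CharZero K]

/-- If the degrees and the orders of vanishing at `0` of `p` and `g` are distinct and their
Wronskian is a monomial, then both are monomials. -/
theorem natDegree_eq_natTrailingDegree_of_wronskian_eq_monomial {p g : K[X]} {c : K} {n : ℕ}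
    (hp : p ≠ 0) (hg : g ≠ 0) (hdeg : p.natDegree ≠ g.natDegree)
    (htrail : p.natTrailingDegree ≠ g.natTrailingDegree) (hW : wronskian p g = C c * X ^ n) :
    p.natDegree + g.natDegree = n + 1 ∧
      p.natDegree ≤ p.natTrailingDegree ∧ g.natDegree ≤ g.natTrailingDegree := by
  have hX : X * wronskian p g = C c * X ^ (n + 1) := by rw [hW]; ring
  have hexp {i : ℕ} (hi : (X * wronskian p g).coeff i ≠ 0) : i = n + 1 := by
    by_contra hne
    rw [hX, coeff_C_mul_X_pow, if_neg hne] at hi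
    exact hi rfl
  have htop : p.natDegree + g.natDegree = n + 1 := hexp <| by
    rw [coeff_X_mul_wronskian_of_natDegree_le le_rfl le_rfl]
    exact mul_ne_zero (sub_ne_zero.2 <| Nat.cast_injective.ne hdeg.symm)
      (mul_ne_zero (leadingCoeff_ne_zero.2 hp) (leadingCoeff_ne_zero.2 hg))
  have hbot : p.natTrailingDegree + g.natTrailingDegree = n + 1 := hexp <| by
    rw [coeff_X_mul_wronskian_of_lt_coeff_eq_zero
      (fun _ => coeff_eq_zero_of_lt_natTrailingDegree)
      (fun _ => coeff_eq_zero_of_lt_natTrailingDegree)]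
    exact mul_ne_zero (sub_ne_zero.2 <| Nat.cast_injective.ne htrail.symm)
      (mul_ne_zero (trailingCoeff_nonzero_iff_nonzero.2 hp)
        (trailingCoeff_nonzero_iff_nonzero.2 hg))
  have := natTrailingDegree_le_natDegree p
  have := natTrailingDegree_le_natDegree g
  omega

theorem span_pair_eq_span_X_pow_of_wronskian_eq_monomial {p g : K[X]} {c : K} {n : ℕ}
    (hc : c ≠ 0) (hlt : p.natDegree < g.natDegree) (hW : wronskian p g = C c * X ^ n) :
    ∃ k m : ℕ, k < m ∧ k + m = n + 1 ∧
      Submodule.span K {p, g} = Submodule.span K {X ^ k, X ^ m} := by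
  have hW0 : wronskian p g ≠ 0 := by
    rw [hW]; exact mul_ne_zero (C_ne_zero.2 hc) (pow_ne_zero _ X_ne_zero)
  have hp : p ≠ 0 := by rintro rfl; simp at hW0
  have hpt : p.coeff p.natTrailingDegree ≠ 0 := trailingCoeff_nonzero_iff_nonzero.2 hp
  set t : K := -(g.coeff p.natTrailingDegree / p.coeff p.natTrailingDegree)
  have hcoeff : (g + t • p).coeff p.natTrailingDegree = 0 := by
    rw [coeff_add, coeff_smul, smul_eq_mul]
    simp only [t]
    field_simp
    ring
  have hdeg : (g + t • p).natDegree = g.natDegree :=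
    natDegree_add_eq_left_of_natDegree_lt ((natDegree_smul_le t p).trans_lt hlt)
  rw [← wronskian_add_smul_self p g t] at hW hW0
  rw [← span_pair_add_smul_self p g t]
  rw [← hdeg] at hlt
  generalize g + t • p = s at *
  have hs : s ≠ 0 := by rintro rfl; simp at hW0
  have htrail : p.natTrailingDegree ≠ s.natTrailingDegree := fun h =>
    trailingCoeff_nonzero_iff_nonzero.2 hs (by rw [trailingCoeff, ← h, hcoeff])
  obtain ⟨hsum, hp', hs'⟩ :=
    natDegree_eq_natTrailingDegree_of_wronskian_eq_monomial hp hs hlt.ne htrail hW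
  refine ⟨p.natDegree, s.natDegree, hlt, hsum, ?_⟩
  rw [← span_pair_C_mul (leadingCoeff_ne_zero.2 hp) (leadingCoeff_ne_zero.2 hs)
      (X ^ p.natDegree),
    ← eq_C_mul_X_pow_of_natDegree_le_natTrailingDegree hp',
    ← eq_C_mul_X_pow_of_natDegree_le_natTrailingDegree hs']

end Field

end Polynomial

/-- The fibers of the Wronski map over monomials (Section 7): if `V` is a two-dimensional
subspace of the polynomials of degree at most `d` and the Wronskian of some basis of `V`
equals `c·zⁿ` with `c ≠ 0` and `0 ≤ n ≤ 2d−2`, then `V = span{z^k, z^m}` for some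
`0 ≤ k < m ≤ d` with `k + m = n + 1`. -/
theorem wronskian_monomial_fibers (d n : ℕ) (hd : 1 ≤ d) (hn : n ≤ 2 * d - 2)
    (V : Submodule ℂ ℂ[X]) (hVle : V ≤ Polynomial.degreeLE ℂ (d : ℕ))
    (hV2 : Module.finrank ℂ V = 2)
    (r q : ℂ[X]) (hr : r ∈ V) (hq : q ∈ V) (hspan : Submodule.span ℂ {r, q} = V)
    (c : ℂ) (hc : c ≠ 0)
    (hW : r * derivative q - derivative r * q = C c * X ^ n) :
    ∃ k m : ℕ, k < m ∧ m ≤ d ∧ k + m = n + 1 ∧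
      V = Submodule.span ℂ {(X : ℂ[X]) ^ k, X ^ m} := by
  have hW0 : wronskian r q ≠ 0 := by
    rw [wronskian, hW]; exact mul_ne_zero (C_ne_zero.2 hc) (pow_ne_zero _ X_ne_zero)
  obtain ⟨p, g, hlt, hpg, hsign⟩ := exists_natDegree_lt_of_wronskian_ne_zero hW0
  obtain ⟨c', hc', hW'⟩ : ∃ c' : ℂ, c' ≠ 0 ∧ wronskian p g = C c' * X ^ n := by
    rcases hsign with h | h
    · exact ⟨c, hc, h.trans hW⟩
    · exact ⟨-c, neg_ne_zero.2 hc, by rw [h, wronskian, hW, C_neg, neg_mul]⟩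
  obtain ⟨k, m, hkm, hsum, hkmspan⟩ :=
    span_pair_eq_span_X_pow_of_wronskian_eq_monomial hc' hlt hW'
  have hV : V = Submodule.span ℂ {(X : ℂ[X]) ^ k, X ^ m} := by rw [← hspan, ← hpg, hkmspan]
  refine ⟨k, m, hkm, ?_, hsum, hV⟩
  have hm : (X : ℂ[X]) ^ m ∈ degreeLE ℂ (d : ℕ) :=
    hVle (hV ▸ Submodule.subset_span (by simp))
  rw [mem_degreeLE, degree_X_pow] at hm
  exact_mod_cast hm
end

section
/- Let f₁(z) = z³ + 3i·z² and f₀(z) = z − i. Then the Wronskian W(f₀, f₁) = f₀·f₁′ − f₀′·f₁ equals 2z³ + 6z, which has real coefficients; nevertheless, no nontrivial complex linear combination of f₀ and f₁ is a polynomial with real coefficients: if α, β ∈ ℂ and α·f₀ + β·f₁ has all coefficients real, then α = β = 0. -/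
open Polynomial

/-- The example after Theorem 1 in the introduction: with `f₁(z) = z³ + 3i z²` and
`f₀(z) = z − i`, the Wronskian `W(f₀,f₁) = f₀·f₁′ − f₀′·f₁` equals `2z³ + 6z`,
which has real coefficients, yet no nontrivial complex linear combination of `f₀` and `f₁`
is a polynomial with real coefficients. -/
theorem wronskian_real_but_pair_not_real :
    let f₁ : ℂ[X] := X ^ 3 + C (3 * Complex.I) * X ^ 2
    let f₀ : ℂ[X] := X - C Complex.I
    (f₀ * derivative f₁ - derivative f₀ * f₁ = 2 * X ^ 3 + 6 * X) ∧
    (∀ α β : ℂ, (∀ n : ℕ, ((α • f₀ + β • f₁).coeff n).im = 0) → α = 0 ∧ β = 0) := by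
  intro f₁ f₀
  constructor
  · have hI : (C Complex.I : ℂ[X]) ^ 2 = -1 := by
      rw [← C_pow, Complex.I_sq, C_neg, C_1]
    simp only [f₁, f₀, derivative_sub, derivative_add, derivative_mul, derivative_X_pow,
      derivative_X, derivative_C, C_mul]
    simp only [map_ofNat, Nat.cast_ofNat]
    linear_combination (-6 * X) * hI
  · intro α β h
    have h0 := h 0
    have h1 := h 1
    have h2 := h 2
    have h3 := h 3
    simp [f₁, f₀, coeff_X, coeff_C, coeff_X_pow, mul_assoc] at h0 h1 h2 h3
    exact ⟨Complex.ext h0 h1, Complex.ext h2 h3⟩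
end
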